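/- arXiv:2604.20984 — 3 statements merged into one kernel-verified Lean document; each statement's English description precedes it below -/
import Mathlib

section
/- Let p ∈ (1,∞) and let W be a graphon (measurable, symmetric, nonnegative, W ∈ L¹((0,1)²), with degree d_W(x) = ∫₀¹ W(x,y) dy ≤ 1 for a.e. x). Then for every u ∈ L^p((0,1)), the dissipativity inequality ∫₀¹ ∫₀¹ W(x,y) (u(y) − u(x)) |u(x)|^{p−2} u(x) dy dx ≤ 0 holds. -/
open MeasureTheory Set ENNReal

/-- Lebesgue measure restricted to the interval (0,1). -/
noncomputable def mu01 : Measure ℝ := volume.restrict (Set.Ioo 0 1)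

/-- A graphon: a measurable, symmetric, nonnegative kernel in L^1((0,1)^2)
whose degree function is bounded by 1 a.e. -/
def IsGraphon (W : ℝ → ℝ → ℝ) : Prop :=
  Measurable (Function.uncurry W) ∧
  (∀ x y, W x y = W y x) ∧
  (∀ x y, 0 ≤ W x y) ∧
  Integrable (Function.uncurry W) (mu01.prod mu01) ∧
  (∀ᵐ x ∂mu01, (∫ y, W x y ∂mu01) ≤ 1)

/-- The graphon diffusion operator (graphon Laplacian)
`ℒ^W u (x) = ∫₀¹ W x y (u y - u x) dy`. -/
noncomputable def graphonLap (W : ℝ → ℝ → ℝ) (u : ℝ → ℝ) : ℝ → ℝ :=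
  fun x => ∫ y, W x y * (u y - u x) ∂mu01


lemma aux_abs (p : ℝ) (hp : 1 < p) (a : ℝ) : |a| ^ (p - 2) * |a| = |a| ^ (p - 1) := by
  rcases eq_or_ne a 0 with rfl | h
  · simp [Real.zero_rpow (by linarith : p - 1 ≠ 0)]
  · have h' : 0 < |a| := abs_pos.mpr h
    rw [← Real.rpow_add_one h'.ne']
    congr 1; ring

lemma aux_abs2 (p : ℝ) (hp : 1 < p) (a : ℝ) : |a| ^ (p - 1) * |a| = |a| ^ p := by
  rcases eq_or_ne a 0 with rfl | h
  · simp [Real.zero_rpow (by linarith : p ≠ 0)]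
  · have h' : 0 < |a| := abs_pos.mpr h
    rw [← Real.rpow_add_one h'.ne']
    congr 1; ring

lemma aux_mono (p : ℝ) (hp : 1 < p) (a b : ℝ) :
    (b - a) * (|a| ^ (p - 2) * a) + (a - b) * (|b| ^ (p - 2) * b) ≤ 0 := by
  have ha := aux_abs p hp a
  have hb := aux_abs p hp b
  have h1 : 0 ≤ |a| ^ (p - 2) := by positivity
  have h2 : 0 ≤ |b| ^ (p - 2) := by positivity
  have h3 : a * b ≤ |a| * |b| := by rw [← abs_mul]; exact le_abs_self _
  have h4 : 0 ≤ (|b| - |a|) * (|b| ^ (p - 1) - |a| ^ (p - 1)) := by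
    rcases le_total |a| |b| with h | h
    · exact mul_nonneg (by linarith) (sub_nonneg.2
        (Real.rpow_le_rpow (abs_nonneg _) h (by linarith)))
    · exact mul_nonneg_of_nonpos_of_nonpos (by linarith) (sub_nonpos.2
        (Real.rpow_le_rpow (abs_nonneg _) h (by linarith)))
  rw [← ha, ← hb] at h4
  have h5 := mul_le_mul_of_nonneg_left h3 (add_nonneg h1 h2)
  have h6 := abs_mul_abs_self a
  have h7 := abs_mul_abs_self b
  have e : (|b| - |a|) * (|b| ^ (p - 2) * |b| - |a| ^ (p - 2) * |a|)
      = |b| ^ (p - 2) * (|b| * |b|) + |a| ^ (p - 2) * (|a| * |a|)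
        - (|a| ^ (p - 2) + |b| ^ (p - 2)) * (|a| * |b|) := by ring
  rw [e, h6, h7] at h4
  linarith

lemma aux_bound (p : ℝ) (hp : 1 < p) (a b : ℝ) :
    |(b - a) * (|a| ^ (p - 2) * a)| ≤ 2 * |a| ^ p + |b| ^ p := by
  rw [abs_mul, abs_mul, abs_of_nonneg (by positivity : 0 ≤ |a| ^ (p - 2)), aux_abs p hp a]
  have ha := aux_abs2 p hp a
  have hb := aux_abs2 p hp b
  have h1 : 0 ≤ |a| ^ (p - 1) := by positivity
  have h0 : 0 ≤ |b| ^ p := by positivity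
  have h0' : 0 ≤ |a| ^ p := by positivity
  have h2 : |b - a| ≤ |b| + |a| := abs_sub _ _
  have h3 : |b| * |a| ^ (p - 1) ≤ |a| ^ p + |b| ^ p := by
    rcases le_total |a| |b| with h | h
    · have := mul_le_mul_of_nonneg_left
        (Real.rpow_le_rpow (abs_nonneg a) h (by linarith : 0 ≤ p - 1)) (abs_nonneg b)
      linarith
    · have := mul_le_mul_of_nonneg_right h h1
      linarith
  have := mul_le_mul_of_nonneg_right h2 h1
  linarith

instance : IsFiniteMeasure mu01 := by unfold mu01; infer_instance

/-- dissipativity inequality for the graphon diffusion operator: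
for p ∈ (1,∞) and u ∈ L^p((0,1)),
∫∫ W(x,y)(u(y)-u(x)) |u(x)|^{p-2} u(x) dy dx ≤ 0. -/
theorem graphonLap_dissipativity (p : ℝ) (hp : 1 < p)
    (W : ℝ → ℝ → ℝ) (hW : IsGraphon W)
    (u : ℝ → ℝ) (hu : MemLp u (ENNReal.ofReal p) mu01) :
    ∫ x, ∫ y, W x y * (u y - u x) * (|u x| ^ (p - 2) * u x) ∂mu01 ∂mu01 ≤ 0 := by
  obtain ⟨hm, hs, h0, hi, hd⟩ := hW
  have hup : Integrable (fun x => |u x| ^ p) mu01 := by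
    have := hu.integrable_norm_rpow (by simp; linarith) (by simp)
    simpa [ENNReal.toReal_ofReal (by linarith : 0 ≤ p)] using this
  have hum := hu.aestronglyMeasurable
  have hu1 : AEMeasurable (fun z : ℝ × ℝ => u z.1) (mu01.prod mu01) := hum.comp_fst.aemeasurable
  have hu2 : AEMeasurable (fun z : ℝ × ℝ => u z.2) (mu01.prod mu01) := hum.comp_snd.aemeasurable
  have hWm : AEMeasurable (fun z : ℝ × ℝ => W z.1 z.2) (mu01.prod mu01) := hm.aemeasurable
  have hA : Integrable (fun z : ℝ × ℝ => W z.1 z.2 * |u z.1| ^ p) (mu01.prod mu01) := by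
    have hAm : AEStronglyMeasurable (fun z : ℝ × ℝ => W z.1 z.2 * |u z.1| ^ p)
        (mu01.prod mu01) := by
      apply AEMeasurable.aestronglyMeasurable
      exact hWm.mul (hu1.abs.pow_const p)
    rw [integrable_prod_iff hAm]
    refine ⟨?_, ?_⟩
    · filter_upwards [hi.prod_right_ae] with x hx
      exact hx.mul_const _
    · refine hup.mono' hAm.norm.integral_prod_right' ?_
      filter_upwards [hd] with x hx
      have h1 : 0 ≤ |u x| ^ p := by positivity
      have e : ∀ y, ‖W x y * |u x| ^ p‖ = W x y * |u x| ^ p := fun y => by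
        rw [Real.norm_of_nonneg (mul_nonneg (h0 _ _) h1)]
      simp only [e, integral_mul_const]
      rw [Real.norm_of_nonneg (mul_nonneg (integral_nonneg (h0 x)) h1)]
      exact mul_le_of_le_one_left h1 hx
  have hB : Integrable (fun z : ℝ × ℝ => W z.1 z.2 * |u z.2| ^ p) (mu01.prod mu01) := by
    refine hA.swap.congr (Filter.Eventually.of_forall fun z => ?_)
    simp [hs z.2 z.1]
  let F : ℝ × ℝ → ℝ := fun z => W z.1 z.2 * (u z.2 - u z.1) * (|u z.1| ^ (p - 2) * u z.1)
  have hF : Integrable F (mu01.prod mu01) := by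
    refine ((hA.const_mul 2).add hB).mono' ?_ (Filter.Eventually.of_forall fun z => ?_)
    · apply AEMeasurable.aestronglyMeasurable
      exact (hWm.mul (hu2.sub hu1)).mul ((hu1.abs.pow_const _).mul hu1)
    · have := mul_le_mul_of_nonneg_left (aux_bound p hp (u z.1) (u z.2)) (h0 z.1 z.2)
      simp only [F, mul_assoc, Real.norm_eq_abs, Pi.add_apply]
      rw [abs_mul, abs_of_nonneg (h0 _ _)]
      linarith
  have e1 : ∫ x, ∫ y, W x y * (u y - u x) * (|u x| ^ (p - 2) * u x) ∂mu01 ∂mu01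
      = ∫ z, F z ∂(mu01.prod mu01) := (integral_prod F hF).symm
  have e2 : ∫ z, F z.swap ∂(mu01.prod mu01) = ∫ z, F z ∂(mu01.prod mu01) :=
    integral_prod_swap F
  have e3 : ∫ z, (F z + (F ∘ Prod.swap) z) ∂(mu01.prod mu01) ≤ 0 := by
    apply integral_nonpos
    intro z
    have := mul_nonpos_of_nonneg_of_nonpos (h0 z.1 z.2) (aux_mono p hp (u z.1) (u z.2))
    simp only [F, Function.comp_apply, Prod.fst_swap, Prod.snd_swap, hs z.2 z.1, Pi.zero_apply]
    linarith
  rw [integral_add hF hF.swap] at e3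
  have e4 : ∫ z, (F ∘ Prod.swap) z ∂(mu01.prod mu01) = ∫ z, F z ∂(mu01.prod mu01) := e2
  rw [e1]
  linarith
end

section
/- Let p ∈ [1,∞], T > 0, and let W be a graphon (measurable, symmetric, nonnegative, W ∈ L¹((0,1)²), with degree d_W(x) = ∫₀¹ W(x,y) dy ≤ 1 for a.e. x). Then for every u₀ ∈ L^p((0,1)) there exists a unique classical solution u ∈ C¹([0,T]; L^p((0,1))) of the graphon diffusion equation ∂u/∂t = ℒ^W u with u(·,0) = u₀; the solution is given by u(·,t) = e^{tℒ^W} u₀, where e^{tℒ^W} is the operator exponential of the bounded operator ℒ^W on L^p((0,1)), and it satisfies the contraction estimate ‖e^{tℒ^W} u₀‖_{L^p} ≤ ‖u₀‖_{L^p} for all t ≥ 0. -/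
open MeasureTheory Set ENNReal

instance mu01_isProb : IsProbabilityMeasure mu01 := ⟨by simp [mu01]⟩

/-- The degree as an extended nonnegative number. -/
noncomputable def eDeg (W : ℝ → ℝ → ℝ) (x : ℝ) : ℝ≥0∞ := ∫⁻ y, ‖W x y‖ₑ ∂mu01

theorem IsGraphon.measurable_enorm {W : ℝ → ℝ → ℝ} (hW : IsGraphon W) :
    Measurable (fun z : ℝ × ℝ => ‖W z.1 z.2‖ₑ) := hW.1.enorm

theorem IsGraphon.measurable_eDeg {W : ℝ → ℝ → ℝ} (hW : IsGraphon W) : Measurable (eDeg W) :=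
  hW.measurable_enorm.lintegral_prod_right'

theorem IsGraphon.slice {W : ℝ → ℝ → ℝ} (hW : IsGraphon W) :
    ∀ᵐ x ∂mu01, Integrable (W x) mu01 := hW.2.2.2.1.prod_right_ae

theorem IsGraphon.eDeg_eq {W : ℝ → ℝ → ℝ} (hW : IsGraphon W) :
    ∀ᵐ x ∂mu01, eDeg W x = ENNReal.ofReal (∫ y, W x y ∂mu01) := by
  filter_upwards [hW.slice] with x hx
  rw [ofReal_integral_eq_lintegral_ofReal hx (ae_of_all _ (hW.2.2.1 x))]
  simp only [eDeg, Real.enorm_of_nonneg (hW.2.2.1 _ _)]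

theorem IsGraphon.eDeg_le {W : ℝ → ℝ → ℝ} (hW : IsGraphon W) :
    ∀ᵐ x ∂mu01, eDeg W x ≤ 1 := by
  filter_upwards [hW.eDeg_eq, hW.2.2.2.2] with x hx h1
  rw [hx]
  exact ENNReal.ofReal_le_one.2 h1

theorem IsGraphon.tonelli {W : ℝ → ℝ → ℝ} (hW : IsGraphon W) {F : ℝ → ℝ≥0∞} (hF : Measurable F) :
    ∫⁻ x, ∫⁻ y, ‖W x y‖ₑ * F y ∂mu01 ∂mu01 = ∫⁻ y, eDeg W y * F y ∂mu01 := by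
  rw [lintegral_lintegral_swap]
  · refine lintegral_congr fun y => ?_
    rw [lintegral_mul_const]
    · simp only [eDeg, hW.2.1 y]
    · exact hW.measurable_enorm.comp (measurable_id.prodMk measurable_const)
  · exact (hW.measurable_enorm.mul (hF.comp measurable_snd)).aemeasurable

theorem IsGraphon.core {W : ℝ → ℝ → ℝ} (hW : IsGraphon W) {F : ℝ → ℝ≥0∞} (hF : Measurable F) :
    ∫⁻ x, ((∫⁻ y, ‖W x y‖ₑ * F y ∂mu01) + (1 - eDeg W x) * F x) ∂mu01 = ∫⁻ y, F y ∂mu01 := by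
  have hm1 : Measurable (fun x => (1 - eDeg W x) * F x) :=
    (measurable_const.sub hW.measurable_eDeg).mul hF
  have hm2 : Measurable (fun x => eDeg W x * F x) := hW.measurable_eDeg.mul hF
  rw [lintegral_add_right _ hm1, hW.tonelli hF, ← lintegral_add_left hm2]
  refine lintegral_congr_ae ?_
  filter_upwards [hW.eDeg_le] with x hx
  rw [← add_mul, add_tsub_cancel_of_le hx, one_mul]

theorem IsGraphon.pointwise {W : ℝ → ℝ → ℝ} (hW : IsGraphon W) {f : ℝ → ℝ} (hf : Measurable f)
    (hfi : Integrable f mu01) :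
    ∀ᵐ x ∂mu01, ‖graphonLap W f x + f x‖ₑ ≤
      (∫⁻ y, ‖W x y‖ₑ * ‖f y‖ₑ ∂mu01) + (1 - eDeg W x) * ‖f x‖ₑ := by
  have hfin : ∀ᵐ x ∂mu01, ∫⁻ y, ‖W x y‖ₑ * ‖f y‖ₑ ∂mu01 < ∞ := by
    refine ae_lt_top ?_ ?_
    · exact (hW.measurable_enorm.mul (hf.enorm.comp measurable_snd)).lintegral_prod_right'
    · rw [hW.tonelli hf.enorm]
      refine ((lintegral_mono_ae ?_).trans_lt hfi.2).ne
      filter_upwards [hW.eDeg_le] with x hx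
      exact mul_le_of_le_one_left zero_le hx
  filter_upwards [hfin, hW.slice, hW.eDeg_eq, hW.2.2.2.2] with x hx hs hd h1
  have hmeas : Measurable (W x) := hW.1.comp (measurable_const.prodMk measurable_id)
  have hi : Integrable (fun y => W x y * f y) mu01 :=
    ⟨(hmeas.mul hf).aestronglyMeasurable, by simpa [HasFiniteIntegral, enorm_mul] using hx⟩
  have e : graphonLap W f x + f x = (∫ y, W x y * f y ∂mu01) + (1 - ∫ y, W x y ∂mu01) * f x := by
    simp only [graphonLap, mul_sub]
    rw [integral_sub hi (hs.mul_const _), integral_mul_const]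
    ring
  rw [e]
  refine (enorm_add_le _ _).trans (add_le_add ?_ ?_)
  · refine (enorm_integral_le_lintegral_enorm _).trans_eq ?_
    simp only [enorm_mul]
  · rw [enorm_mul, hd, Real.enorm_of_nonneg (sub_nonneg.2 h1),
      ENNReal.ofReal_sub _ (integral_nonneg (hW.2.2.1 x)), ENNReal.ofReal_one]

theorem IsGraphon.jensen {W : ℝ → ℝ → ℝ} (hW : IsGraphon W) {F : ℝ → ℝ≥0∞} (hF : Measurable F)
    {q : ℝ} (hq : 1 ≤ q) {x : ℝ} (hx : eDeg W x ≤ 1) :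
    ((∫⁻ y, ‖W x y‖ₑ * F y ∂mu01) + (1 - eDeg W x) * F x) ^ q ≤
      (∫⁻ y, ‖W x y‖ₑ * F y ^ q ∂mu01) + (1 - eDeg W x) * F x ^ q := by
  have hmeas : Measurable (fun y => ‖W x y‖ₑ) :=
    hW.measurable_enorm.comp (measurable_const.prodMk measurable_id)
  let ν : Measure ℝ := mu01.withDensity (fun y => ‖W x y‖ₑ) + (1 - eDeg W x) • Measure.dirac x
  have hν : ∀ G : ℝ → ℝ≥0∞, Measurable G →
      ∫⁻ y, G y ∂ν = (∫⁻ y, ‖W x y‖ₑ * G y ∂mu01) + (1 - eDeg W x) * G x := by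
    intro G hG
    simp only [ν]
    rw [lintegral_add_measure, lintegral_smul_measure, lintegral_dirac' _ hG,
      lintegral_withDensity_eq_lintegral_mul _ hmeas hG]
    rfl
  haveI : IsProbabilityMeasure ν := ⟨by
    have := hν 1 measurable_const
    simp only [Pi.one_apply, lintegral_one, mul_one] at this
    rw [this]
    exact add_tsub_cancel_of_le hx⟩
  have h := eLpNorm'_le_eLpNorm'_of_exponent_le (f := F) one_pos hq ν hF.aestronglyMeasurable
  simp only [eLpNorm', enorm_eq_self, ENNReal.rpow_one, div_one] at h
  rw [← hν F hF, ← hν _ (hF.pow_const q)]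
  have h2 := ENNReal.rpow_le_rpow h (zero_le_one.trans hq)
  rwa [← ENNReal.rpow_mul, one_div, inv_mul_cancel₀ (by positivity), ENNReal.rpow_one] at h2

theorem IsGraphon.eLpNorm_le {W : ℝ → ℝ → ℝ} (hW : IsGraphon W) {p : ℝ≥0∞} (hp : 1 ≤ p)
    {f : ℝ → ℝ} (hf : Measurable f) (hfp : MemLp f p mu01) :
    eLpNorm (fun x => graphonLap W f x + f x) p mu01 ≤ eLpNorm f p mu01 := by
  have hpt := hW.pointwise hf (hfp.integrable hp)
  rcases eq_or_ne p ∞ with rfl | hpt'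
  · simp only [eLpNorm_exponent_top]
    refine eLpNormEssSup_le_of_ae_enorm_bound ?_
    have hM := enorm_ae_le_eLpNormEssSup f mu01
    filter_upwards [hpt, hM, hW.eDeg_le] with x hx hMx hD
    refine hx.trans ?_
    have h1 : ∫⁻ y, ‖W x y‖ₑ * ‖f y‖ₑ ∂mu01 ≤ eDeg W x * eLpNormEssSup f mu01 := by
      have hmeas : Measurable (fun y => ‖W x y‖ₑ) :=
        hW.measurable_enorm.comp (measurable_const.prodMk measurable_id)
      rw [eDeg, ← lintegral_mul_const _ hmeas]
      refine lintegral_mono_ae ?_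
      filter_upwards [hM] with y hy
      gcongr
    calc _ ≤ eDeg W x * eLpNormEssSup f mu01 + (1 - eDeg W x) * eLpNormEssSup f mu01 := by gcongr
      _ = _ := by rw [← add_mul, add_tsub_cancel_of_le hD, one_mul]
  · have hp0 : p ≠ 0 := (zero_lt_one.trans_le hp).ne'
    have hq : 1 ≤ p.toReal := by
      simpa using ENNReal.toReal_mono hpt' hp
    rw [eLpNorm_eq_lintegral_rpow_enorm_toReal hp0 hpt',
      eLpNorm_eq_lintegral_rpow_enorm_toReal hp0 hpt']
    refine ENNReal.rpow_le_rpow ?_ (by positivity)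
    rw [← hW.core (hf.enorm.pow_const p.toReal)]
    refine lintegral_mono_ae ?_
    filter_upwards [hpt, hW.eDeg_le] with x hx hD
    exact (ENNReal.rpow_le_rpow hx (by positivity)).trans (hW.jensen hf.enorm hq hD)

theorem IsGraphon.norm_add_one_le {W : ℝ → ℝ → ℝ} (hW : IsGraphon W) {p : ℝ≥0∞} [hp : Fact (1 ≤ p)]
    (L : Lp ℝ p mu01 →L[ℝ] Lp ℝ p mu01)
    (hL : ∀ f : Lp ℝ p mu01, (L f : ℝ → ℝ) =ᵐ[mu01] graphonLap W f) : ‖L + 1‖ ≤ 1 := by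
  refine ContinuousLinearMap.opNorm_le_bound _ zero_le_one fun f => ?_
  rw [one_mul, Lp.norm_def, Lp.norm_def]
  refine ENNReal.toReal_mono (Lp.eLpNorm_ne_top f) ?_
  refine (eLpNorm_congr_ae ?_).trans_le
    (hW.eLpNorm_le hp.out (Lp.stronglyMeasurable f).measurable (Lp.memLp f))
  have : (L + 1) f = L f + f := rfl
  rw [this]
  filter_upwards [Lp.coeFn_add (L f) f, hL f] with x h1 h2
  rw [h1, Pi.add_apply, h2]

theorem norm_exp_le_of_norm_le {A : Type*} [NormedRing A] [NormOneClass A] [NormedAlgebra ℝ A]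
    [CompleteSpace A] (a : A) : ‖NormedSpace.exp a‖ ≤ Real.exp ‖a‖ := by
  have h := NormedSpace.exp_series_hasSum_exp' (𝕂 := ℝ) a
  have h2 := NormedSpace.exp_series_hasSum_exp' (𝕂 := ℝ) ‖a‖
  rw [← Real.exp_eq_exp_ℝ] at h2
  refine h.norm_le_of_bounded h2 fun n => ?_
  rw [norm_smul, Real.norm_of_nonneg (by positivity), smul_eq_mul]
  gcongr
  exact norm_pow_le a n

theorem norm_exp_contraction {E : Type*} [NormedAddCommGroup E] [NormedSpace ℝ E] [CompleteSpace E]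
    (L : E →L[ℝ] E) (hL : ‖L + 1‖ ≤ 1) (t : ℝ) (ht : 0 ≤ t) : ‖NormedSpace.exp (t • L)‖ ≤ 1 := by
  letI : NormedAlgebra ℚ (E →L[ℝ] E) := NormedAlgebra.restrictScalars ℚ ℝ _
  rcases subsingleton_or_nontrivial E with hE | hE
  · have : NormedSpace.exp (t • L) = 0 := Subsingleton.elim _ _
    simp [this]
  have e : t • L = algebraMap ℝ (E →L[ℝ] E) (-t) + t • (L + 1) := by
    rw [Algebra.algebraMap_eq_smul_one, smul_add, neg_smul]; abel
  rw [e, NormedSpace.exp_add_of_commute (Algebra.commutes _ _),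
    ← NormedSpace.algebraMap_exp_comm, ← Real.exp_eq_exp_ℝ]
  refine (norm_mul_le _ _).trans ?_
  rw [norm_algebraMap', Real.norm_of_nonneg (Real.exp_pos _).le]
  have h := norm_exp_le_of_norm_le (t • (L + 1))
  have h3 : ‖t • (L + 1)‖ ≤ t := by
    rw [norm_smul, Real.norm_of_nonneg ht]
    exact mul_le_of_le_one_right ht hL
  calc _ ≤ Real.exp (-t) * Real.exp t := by
        gcongr
        exact h.trans (Real.exp_le_exp.2 h3)
    _ = 1 := by rw [← Real.exp_add]; simp

/-- well-posedness of the graphon diffusion equation: for p ∈ [1,∞],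
T > 0 and u₀ ∈ L^p((0,1)), the function t ↦ e^{tℒ^W} u₀ is a classical solution on
[0,T] with initial value u₀, every classical solution with initial value u₀ agrees
with it on [0,T], and the contraction estimate ‖e^{tℒ^W} u₀‖_p ≤ ‖u₀‖_p holds for
all t ≥ 0. -/
theorem graphonDiffusion_wellPosed (p : ℝ≥0∞) [Fact (1 ≤ p)]
    (T : ℝ) (hT : 0 < T)
    (W : ℝ → ℝ → ℝ) (hW : IsGraphon W)
    (L : Lp ℝ p mu01 →L[ℝ] Lp ℝ p mu01)
    (hL : ∀ f : Lp ℝ p mu01, (L f : ℝ → ℝ) =ᵐ[mu01] graphonLap W f)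
    (u₀ : Lp ℝ p mu01) :
    (NormedSpace.exp ((0:ℝ) • L) u₀ = u₀) ∧
    (∀ t ∈ Icc (0:ℝ) T,
      HasDerivWithinAt (fun s : ℝ => NormedSpace.exp (s • L) u₀)
        (L (NormedSpace.exp (t • L) u₀)) (Icc 0 T) t) ∧
    (∀ u : ℝ → Lp ℝ p mu01, u 0 = u₀ →
      (∀ t ∈ Icc (0:ℝ) T, HasDerivWithinAt u (L (u t)) (Icc 0 T) t) →
      ∀ t ∈ Icc (0:ℝ) T, u t = NormedSpace.exp (t • L) u₀) ∧
    (∀ t : ℝ, 0 ≤ t → ‖NormedSpace.exp (t • L) u₀‖ ≤ ‖u₀‖) := by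
  have hder : ∀ t : ℝ, HasDerivAt (fun s : ℝ => NormedSpace.exp (s • L) u₀)
      (L (NormedSpace.exp (t • L) u₀)) t := fun t => by
    have h := (hasDerivAt_exp_smul_const' (𝕂 := ℝ) L t).clm_apply (hasDerivAt_const t u₀)
    simpa using h
  have h0 : NormedSpace.exp ((0:ℝ) • L) u₀ = u₀ := by
    rw [zero_smul, NormedSpace.exp_zero]; rfl
  refine ⟨h0, fun t _ => (hder t).hasDerivWithinAt, ?_, ?_⟩
  · intro u hu0 hu
    have hmem : ∀ t ∈ Ico (0:ℝ) T, Icc 0 T ∈ nhdsWithin t (Ici t) := fun t ht =>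
      Filter.mem_of_superset (Icc_mem_nhdsGE ht.2) (Icc_subset_Icc_left ht.1)
    exact ODE_solution_unique (v := fun _ => L) (fun _ => L.lipschitz)
      (fun t ht => (hu t ht).continuousWithinAt)
      (fun t ht => (hu t (Ico_subset_Icc_self ht)).mono_of_mem_nhdsWithin (hmem t ht))
      (fun t _ => (hder t).continuousAt.continuousWithinAt)
      (fun t _ => (hder t).hasDerivWithinAt) (hu0.trans h0.symm)
  · intro t ht
    refine (ContinuousLinearMap.le_opNorm _ _).trans ?_
    exact mul_le_of_le_one_left (norm_nonneg _)
      (norm_exp_contraction L (hW.norm_add_one_le L hL) t ht)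
end

section
/- Let T > 0. Let W_n and W be graphons (measurable, symmetric, nonnegative, with degrees bounded by 1 a.e.) that in addition belong to L^∞((0,1)²). Let u_n ∈ C¹([0,T]; L^∞((0,1))) be a classical solution of ∂u_n/∂t = ℒ^{W_n} u_n and let u ∈ C¹([0,T]; L^∞((0,1))) be a classical solution of ∂u/∂t = ℒ^W u, with initial conditions u_n(·,0), u(·,0) ∈ L^∞((0,1)). Then for all t ∈ [0,T], ‖u(·,t) − u_n(·,t)‖_{L^∞} ≤ ‖u(·,0) − u_n(·,0)‖_{L^∞} + 2 t ‖u(·,0)‖_{L^∞} ‖W_n − W‖_{L^∞}. -/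
open MeasureTheory Set ENNReal

instance mu01_prob : IsProbabilityMeasure mu01 := by
  constructor
  simp [mu01]

theorem ae_norm_le_Linfty (f : Lp ℝ ⊤ mu01) : ∀ᵐ x ∂mu01, ‖f x‖ ≤ ‖f‖ := by
  have h := ae_le_eLpNormEssSup (f := (f : ℝ → ℝ)) (μ := mu01)
  have hf := Lp.eLpNorm_lt_top f
  filter_upwards [h] with x hx
  rw [Lp.norm_def]
  rw [eLpNorm_exponent_top] at hf ⊢
  rw [← toReal_enorm]
  exact ENNReal.toReal_mono hf.ne hx

theorem norm_le_Linfty (f : Lp ℝ ⊤ mu01) (C : ℝ) (hC : 0 ≤ C)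
    (h : ∀ᵐ x ∂mu01, ‖f x‖ ≤ C) : ‖f‖ ≤ C := by
  have := Lp.norm_le_of_ae_bound (f := f) hC h
  simpa using this

theorem slice_integrable (W : ℝ → ℝ → ℝ) (hW : IsGraphon W) (f : Lp ℝ ⊤ mu01) :
    ∀ᵐ x ∂mu01, Integrable (fun y => W x y) mu01 ∧ Integrable (fun y => W x y * f y) mu01 := by
  obtain ⟨_, _, _, hi, _⟩ := hW
  filter_upwards [hi.prod_right_ae] with x hx
  refine ⟨hx, ?_⟩
  exact hx.mul_bdd (c := ‖f‖) (Lp.aestronglyMeasurable f) (ae_norm_le_Linfty f)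

theorem lap_contract (W : ℝ → ℝ → ℝ) (hW : IsGraphon W)
    (L : Lp ℝ ⊤ mu01 →L[ℝ] Lp ℝ ⊤ mu01)
    (hL : ∀ f : Lp ℝ ⊤ mu01, (L f : ℝ → ℝ) =ᵐ[mu01] graphonLap W f)
    (f : Lp ℝ ⊤ mu01) (h : ℝ) (h0 : 0 ≤ h) (h1 : h ≤ 1) : ‖f + h • L f‖ ≤ ‖f‖ := by
  apply norm_le_Linfty _ _ (norm_nonneg _)
  have hpos := hW.2.2.1
  filter_upwards [Lp.coeFn_add f (h • L f), Lp.coeFn_smul h (L f), hL f,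
    slice_integrable W hW f, hW.2.2.2.2, ae_norm_le_Linfty f] with x e1 e2 e3 hi hd hfx
  rw [e1, Pi.add_apply, e2, Pi.smul_apply, e3, smul_eq_mul]
  have e4 : graphonLap W f x = (∫ y, W x y * f y ∂mu01) - (∫ y, W x y ∂mu01) * f x := by
    unfold graphonLap
    simp only [mul_sub]
    rw [integral_sub hi.2 (hi.1.mul_const _), integral_mul_const]
  have hb : ‖∫ y, W x y * f y ∂mu01‖ ≤ (∫ y, W x y ∂mu01) * ‖f‖ := by
    rw [← integral_mul_const]
    apply norm_integral_le_of_norm_le (hi.1.mul_const _)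
    filter_upwards [ae_norm_le_Linfty f] with y hy
    rw [norm_mul, Real.norm_of_nonneg (hpos x y)]
    exact mul_le_mul_of_nonneg_left hy (hpos x y)
  have hd0 : 0 ≤ ∫ y, W x y ∂mu01 := integral_nonneg (hpos x)
  rw [e4]
  generalize (∫ y, W x y ∂mu01) = d at *
  generalize (∫ y, W x y * f y ∂mu01) = I at *
  have hhd : 0 ≤ 1 - h * d := by nlinarith
  calc ‖f x + h * (I - d * f x)‖ = ‖(1 - h * d) * f x + h * I‖ := by ring_nf
    _ ≤ ‖(1 - h * d) * f x‖ + ‖h * I‖ := norm_add_le _ _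
    _ = (1 - h * d) * ‖f x‖ + h * ‖I‖ := by
      rw [norm_mul, norm_mul, Real.norm_of_nonneg hhd, Real.norm_of_nonneg h0]
    _ ≤ (1 - h * d) * ‖f‖ + h * (d * ‖f‖) := by gcongr
    _ = ‖f‖ := by ring

theorem lap_diff (Wn W : ℝ → ℝ → ℝ) (hWn : IsGraphon Wn) (hW : IsGraphon W)
    (hWnInfty : MemLp (Function.uncurry Wn) ⊤ (mu01.prod mu01))
    (hWInfty : MemLp (Function.uncurry W) ⊤ (mu01.prod mu01))
    (Ln : Lp ℝ ⊤ mu01 →L[ℝ] Lp ℝ ⊤ mu01)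
    (hLn : ∀ f : Lp ℝ ⊤ mu01, (Ln f : ℝ → ℝ) =ᵐ[mu01] graphonLap Wn f)
    (L : Lp ℝ ⊤ mu01 →L[ℝ] Lp ℝ ⊤ mu01)
    (hL : ∀ f : Lp ℝ ⊤ mu01, (L f : ℝ → ℝ) =ᵐ[mu01] graphonLap W f)
    (f : Lp ℝ ⊤ mu01) :
    ‖L f - Ln f‖ ≤ 2 * ‖f‖ *
        (eLpNorm (Function.uncurry fun x y => Wn x y - W x y) ⊤ (mu01.prod mu01)).toReal := by
  have hfin : eLpNorm (Function.uncurry fun x y => Wn x y - W x y) ⊤ (mu01.prod mu01) ≠ ⊤ :=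
    (hWnInfty.sub hWInfty).2.ne
  have hD : ∀ᵐ p ∂(mu01.prod mu01), ‖Wn p.1 p.2 - W p.1 p.2‖ ≤
      (eLpNorm (Function.uncurry fun x y => Wn x y - W x y) ⊤ (mu01.prod mu01)).toReal := by
    have h := ae_le_eLpNormEssSup (f := (Function.uncurry fun x y => Wn x y - W x y))
      (μ := mu01.prod mu01)
    filter_upwards [h] with p hp
    rw [← toReal_enorm]
    apply ENNReal.toReal_mono hfin
    rw [eLpNorm_exponent_top]
    exact hp
  generalize (eLpNorm (Function.uncurry fun x y => Wn x y - W x y) ⊤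
    (mu01.prod mu01)) = D at *
  apply norm_le_Linfty _ _ (by positivity)
  filter_upwards [Lp.coeFn_sub (L f) (Ln f), hL f, hLn f, slice_integrable W hW f,
    slice_integrable Wn hWn f, ae_norm_le_Linfty f, Measure.ae_ae_of_ae_prod hD]
    with x e1 e2 e3 hi hin hfx hDx
  rw [e1, Pi.sub_apply, e2, e3]
  unfold graphonLap
  have i1 : Integrable (fun y => W x y * (f y - f x)) mu01 := by
    simp only [mul_sub]
    exact hi.2.sub (hi.1.mul_const _)
  have i2 : Integrable (fun y => Wn x y * (f y - f x)) mu01 := by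
    simp only [mul_sub]
    exact hin.2.sub (hin.1.mul_const _)
  rw [← integral_sub i1 i2]
  have := norm_integral_le_of_norm_le_const (μ := mu01)
    (f := fun y => W x y * (f y - f x) - Wn x y * (f y - f x)) (C := 2 * ‖f‖ * D.toReal) (by
      filter_upwards [hDx, ae_norm_le_Linfty f] with y hy hfy
      rw [← sub_mul, norm_mul, norm_sub_rev, mul_comm]
      have : ‖f y - f x‖ ≤ 2 * ‖f‖ := (norm_sub_le _ _).trans (by linarith)
      gcongr)
  simpa using this

theorem gronwall_contract {E : Type*} [NormedAddCommGroup E] [NormedSpace ℝ E] (A : E → E)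
    (hA : ∀ f : E, ∀ h : ℝ, 0 ≤ h → h ≤ 1 → ‖f + h • A f‖ ≤ ‖f‖) (T K : ℝ)
    (w g : ℝ → E) (hg : ∀ t ∈ Icc (0:ℝ) T, ‖g t‖ ≤ K)
    (hw : ∀ t ∈ Icc (0:ℝ) T, HasDerivWithinAt w (A (w t) + g t) (Icc 0 T) t) :
    ∀ t ∈ Icc (0:ℝ) T, ‖w t‖ ≤ ‖w 0‖ + K * t := by
  have hc : ContinuousOn w (Icc 0 T) := fun t ht => (hw t ht).continuousWithinAt
  intro t ht
  refine image_le_of_liminf_slope_right_le_deriv_boundary (f := fun t => ‖w t‖)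
    (B := fun t => ‖w 0‖ + K * t) (B' := fun _ => K) hc.norm (by simp) (by fun_prop) ?_ ?_ ht
  · intro x _
    have := ((hasDerivAt_id x).const_mul K).const_add ‖w 0‖
    simpa using this.hasDerivWithinAt
  · intro x hx r hr
    apply Filter.Eventually.frequently
    have hd := (hw x ⟨hx.1, hx.2.le⟩).mono_of_mem_nhdsWithin (s := Ioi x)
      (Filter.mem_of_superset (Ioo_mem_nhdsGT hx.2)
        (fun z hz => ⟨hx.1.trans hz.1.le, hz.2.le⟩))
    have ho := (hasDerivWithinAt_iff_isLittleO.1 hd).def (c := (r - K) / 2) (by linarith)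
    filter_upwards [ho, Ioo_mem_nhdsGT (show x < x + 1 by linarith)] with z hz hz1
    have hp : 0 < z - x := by linarith [hz1.1]
    rw [slope_def_field, div_lt_iff₀ hp]
    rw [Real.norm_of_nonneg hp.le] at hz
    have h1 := hA (w x) (z - x) hp.le (by linarith [hz1.2])
    have h2 := hg x ⟨hx.1, hx.2.le⟩
    have h3 : ‖w z‖ ≤ ‖w x + (z - x) • A (w x)‖ + ‖(z - x) • g x‖
        + ‖w z - w x - (z - x) • (A (w x) + g x)‖ := by
      refine le_trans (le_of_eq ?_) (norm_add₃_le)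
      congr 1
      rw [smul_add]; abel
    rw [norm_smul, Real.norm_of_nonneg hp.le] at h3
    nlinarith [mul_le_mul_of_nonneg_left h2 hp.le, mul_pos hp (sub_pos.2 hr)]

/-- L^∞ convergence of solutions of graph diffusion equations for
L^∞ graphons:
‖u(t) - uₙ(t)‖_∞ ≤ ‖u(0) - uₙ(0)‖_∞ + 2 t ‖u(0)‖_∞ ‖Wₙ - W‖_{L^∞}. -/
theorem graphDiffusion_convergence_Linfty (T : ℝ) (hT : 0 < T)
    (Wn W : ℝ → ℝ → ℝ) (hWn : IsGraphon Wn) (hW : IsGraphon W)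
    (hWnInfty : MemLp (Function.uncurry Wn) ⊤ (mu01.prod mu01))
    (hWInfty : MemLp (Function.uncurry W) ⊤ (mu01.prod mu01))
    (Ln : Lp ℝ ⊤ mu01 →L[ℝ] Lp ℝ ⊤ mu01)
    (hLn : ∀ f : Lp ℝ ⊤ mu01, (Ln f : ℝ → ℝ) =ᵐ[mu01] graphonLap Wn f)
    (L : Lp ℝ ⊤ mu01 →L[ℝ] Lp ℝ ⊤ mu01)
    (hL : ∀ f : Lp ℝ ⊤ mu01, (L f : ℝ → ℝ) =ᵐ[mu01] graphonLap W f)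
    (un : ℝ → Lp ℝ ⊤ mu01) (u : ℝ → Lp ℝ ⊤ mu01)
    (hunsol : ∀ t ∈ Icc (0:ℝ) T, HasDerivWithinAt un (Ln (un t)) (Icc 0 T) t)
    (husol : ∀ t ∈ Icc (0:ℝ) T, HasDerivWithinAt u (L (u t)) (Icc 0 T) t) :
    ∀ t ∈ Icc (0:ℝ) T,
      ‖u t - un t‖ ≤ ‖u 0 - un 0‖ + 2 * t * ‖u 0‖ *
        (eLpNorm (Function.uncurry fun x y => Wn x y - W x y) ⊤ (mu01.prod mu01)).toReal := by
  have hu : ∀ t ∈ Icc (0:ℝ) T, ‖u t‖ ≤ ‖u 0‖ := by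
    intro t ht
    have := gronwall_contract L (lap_contract W hW L hL) T 0 u (fun _ => 0) (by simp)
      (by simpa using husol) t ht
    simpa using this
  intro t ht
  have key := gronwall_contract Ln (lap_contract Wn hWn Ln hLn) T
    (2 * ‖u 0‖ *
        (eLpNorm (Function.uncurry fun x y => Wn x y - W x y) ⊤ (mu01.prod mu01)).toReal)
    (fun t => u t - un t) (fun t => L (u t) - Ln (u t)) ?_ ?_ t ht
  · refine key.trans (le_of_eq ?_)
    ring
  · intro s hs
    refine (lap_diff Wn W hWn hW hWnInfty hWInfty Ln hLn L hL (u s)).trans ?_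
    have := hu s hs
    gcongr
  · intro s hs
    have := (husol s hs).sub (hunsol s hs)
    have e : Ln (u s - un s) + (L (u s) - Ln (u s)) = L (u s) - Ln (un s) := by
      rw [map_sub]; abel
    rw [← e] at this
    exact this
end
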